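/- Let k be a field of characteristic not equal to 2, G a commutative monoid, and A a left-sided G-rigid k-bialgebra. Then every generalized primitive of A is torsion: for every Q ∈ G and every x ∈ GP_Q(A), one has η(Q)x = 0. (The key computation: if Q is a central grouplike and x is a Q-primitive with x² = 0, then 0 = Δ(x²) = 2(Qx ⊗ Qx), forcing Qx = 0.) -/

import Mathlib

/-!
Statement 13: in a left-sided `G`-rigid bialgebra over a field of characteristic ≠ 2,
every generalized primitive is torsion.
-/

open TensorProduct

section Defs

variable (k : Type*) {A : Type*} [CommSemiring k] [Semiring A] [Bialgebra k A]

/-- An element `Q` of a `k`-bialgebra `A` is *grouplike* if `Δ Q = Q ⊗ Q` and `ε Q = 1`. -/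
def IsGrouplike (Q : A) : Prop :=
  Coalgebra.comul (R := k) Q = Q ⊗ₜ[k] Q ∧ Coalgebra.counit (R := k) Q = 1

/-- For `Q` a grouplike, `a` is a *`Q`-primitive* if `Δ a = a ⊗ Q + Q ⊗ a`. -/
def IsPrimitive (Q a : A) : Prop :=
  Coalgebra.comul (R := k) a = a ⊗ₜ[k] Q + Q ⊗ₜ[k] a

/-- A *`G`-rigid `k`-bialgebra* structure on `A`: a multiplicative map `η : G → A` whose
values are central grouplikes, and which is an isomorphism from `G` onto the monoid of
grouplikes of `A`. -/
structure RigidBialgebra (G : Type*) [CommMonoid G] (A : Type*) [Semiring A]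
    [Bialgebra k A] where
  η : G →* A
  grouplike : ∀ g : G, IsGrouplike k (η g)
  central : ∀ (g : G) (a : A), η g * a = a * η g
  injective : Function.Injective η
  surjOn : ∀ a : A, IsGrouplike k a → ∃ g : G, η g = a

variable {G : Type*} [CommMonoid G]

/-- A `G`-rigid `k`-bialgebra is *left-sided* if `x * y = 0` whenever `Q` divides `Q′` in `G`,
`x` is an `η Q`-primitive and `y` is an `η Q′`-primitive. -/
def RigidBialgebra.LeftSided (R : RigidBialgebra k G A) : Prop :=
  ∀ Q Q' : G, Q ∣ Q' → ∀ x y : A,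
    IsPrimitive k (R.η Q) x → IsPrimitive k (R.η Q') y → x * y = 0

end Defs

/-- Over a field, the tensor square `v ⊗ v` of a nonzero vector is nonzero. -/
theorem eq_zero_of_tmul_self_eq_zero {k V : Type*} [Field k] [AddCommGroup V] [Module k V]
    {v : V} (h : v ⊗ₜ[k] v = 0) : v = 0 := by
  refine (Module.forall_dual_apply_eq_zero_iff k v).mp fun f => ?_
  have hf : TensorProduct.lid k k (TensorProduct.map f f (v ⊗ₜ[k] v)) = 0 := by rw [h]; simp
  simpa using hf

/-- If a grouplike `Q` commutes with a `Q`-primitive `x` of square zero, then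
`2 (Q x ⊗ Q x) = 0`. -/
theorem IsPrimitive.two_smul_tmul_eq_zero {k A : Type*} [CommSemiring k] [Semiring A]
    [Bialgebra k A] {Q x : A} (hx : IsPrimitive k Q x) (hQ : Q * x = x * Q) (hsq : x * x = 0) :
    (2 : k) • ((Q * x) ⊗ₜ[k] (Q * x)) = 0 := by
  have h : Coalgebra.comul (R := k) (x * x) = 0 := by rw [hsq, map_zero]
  rw [Bialgebra.comul_mul, hx] at h
  simpa [add_mul, mul_add, hsq, ← hQ, two_smul] using h

/-- **Statement 13.** Let `k` be a field of characteristic `≠ 2`, `G` a commutative monoid and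
`A` a left-sided `G`-rigid `k`-bialgebra.  Then every generalized primitive of `A` is torsion:
for every `Q ∈ G` and every `η Q`-primitive `x`, one has `η Q * x = 0`. -/
theorem leftSided_genPrim_torsion (k G A : Type*) [Field k] [CommMonoid G]
    [Ring A] [Bialgebra k A]
    (h2 : (2 : k) ≠ 0)
    (R : RigidBialgebra k G A) (hls : R.LeftSided) :
    ∀ (Q : G) (x : A), IsPrimitive k (R.η Q) x → R.η Q * x = 0 := by
  intro Q x hx
  have h := hx.two_smul_tmul_eq_zero (R.central Q x) (hls Q Q dvd_rfl x x hx hx)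
  exact eq_zero_of_tmul_self_eq_zero ((smul_eq_zero.mp h).resolve_left h2)
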